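/- Let p and q be distinct odd primes, r ≥ 2 an integer, and n = pqr. Let S be a nonempty proper subset of {0, 1, …, p−1}, set f_1(z) = Σ_{s∈S} (−1)^s z^{rs} (1 − z), and let f_2 be an admissible polynomial. Then F(z) = f_1(z)·Φ_q(−z^{pr}) + f_2(z)·Φ_p(−z^{qr}) satisfies: deg F < n, every coefficient of F lies in {−1, 0, 1}, the nonzero coefficients of F read in order of increasing degree alternate in sign, and Φ_{2n} divides F. -/

import Mathlib

open Polynomial

/-- The nonzero coefficients of `F`, read in order of increasing degree, alternate in sign:
any two nonzero coefficients with only zero coefficients strictly between them have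
opposite signs. -/
def AltSigns (F : Polynomial ℤ) : Prop :=
  ∀ i j : ℕ, i < j → F.coeff i ≠ 0 → F.coeff j ≠ 0 →
    (∀ k, i < k → k < j → F.coeff k = 0) → F.coeff j = -F.coeff i

/-- `F` is a Reinhardt polynomial for `n`: `F(0) = 1`, `deg F < n`, every coefficient lies
in `{-1, 0, 1}`, the nonzero coefficients read in order of increasing degree alternate in
sign beginning and ending with `+1` (so their number is odd), and `Φ_{2n} ∣ F`. -/
def IsReinhardt (n : ℕ) (F : Polynomial ℤ) : Prop :=
  F.coeff 0 = 1 ∧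
  F.degree < (n : WithBot ℕ) ∧
  (∀ k, F.coeff k ∈ ({-1, 0, 1} : Set ℤ)) ∧
  AltSigns F ∧
  (∀ i, F.coeff i ≠ 0 → (∀ k, k < i → F.coeff k = 0) → F.coeff i = 1) ∧
  (∀ i, F.coeff i ≠ 0 → (∀ k, i < k → F.coeff k = 0) → F.coeff i = 1) ∧
  Odd F.support.card ∧
  cyclotomic (2 * n) ℤ ∣ F

/-- The doubled coefficient sequence `u_F : ℤ/2nℤ → ℤ`: `u_F(k)` is the coefficient of
`z^k` in `F` for `0 ≤ k < n`, and `u_F(n + k) = -u_F(k)` for `0 ≤ k < n`. -/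
def uF (n : ℕ) (F : Polynomial ℤ) (k : ZMod (2 * n)) : ℤ :=
  if k.val < n then F.coeff k.val else -F.coeff (k.val - n)

/-- `F` is `m`-antiperiodic: `u_F(k + m) = -u_F(k)` for all `k ∈ ℤ/2nℤ`. -/
def Antiper (n : ℕ) (F : Polynomial ℤ) (m : ℕ) : Prop :=
  ∀ k : ZMod (2 * n), uF n F (k + (m : ZMod (2 * n))) = -uF n F k

/-- `F` is periodic: it is `(n/d)`-antiperiodic for some odd divisor `d > 1` of `n`. -/
def IsPeriodicR (n : ℕ) (F : Polynomial ℤ) : Prop :=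
  ∃ d : ℕ, d ∣ n ∧ Odd d ∧ 1 < d ∧ Antiper n F (n / d)

/-- A block of length `L` of a coefficient sequence `v` is OK with leading sign `ε`:
all entries lie in `{-1, 0, 1}`, the number of nonzero entries is odd, consecutive nonzero
entries alternate in sign, and the first nonzero entry equals `ε`. -/
def BlockOK (L : ℕ) (v : ℕ → ℤ) (ε : ℤ) : Prop :=
  (∀ i, i < L → v i ∈ ({-1, 0, 1} : Set ℤ)) ∧
  Odd (((Finset.range L).filter fun i => v i ≠ 0).card) ∧
  (∀ i j, i < j → j < L → v i ≠ 0 → v j ≠ 0 → (∀ k, i < k → k < j → v k = 0) →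
    v j = -v i) ∧
  (∀ i, i < L → v i ≠ 0 → (∀ k, k < i → v k = 0) → v i = ε)

/-- `f₂ ∈ ℤ[z]` is admissible (for odd prime `q` and `r ≥ 2`): `deg f₂ < qr`, the constant
coefficient is `0`, and the coefficients `c_1, …, c_{qr-1}` split into consecutive blocks
`A_1, B_1, …, A_t, B_t` of length `r` (with `t = (q-1)/2`) followed by a final block `C` of
length `r - 1`, each with an odd number of nonzero entries alternating in sign, the first
nonzero entry of each `A_i` and of `C` being `+1` and that of each `B_i` being `-1`. -/
def Admissible (q r : ℕ) (f₂ : Polynomial ℤ) : Prop :=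
  f₂.degree < ((q * r : ℕ) : WithBot ℕ) ∧
  f₂.coeff 0 = 0 ∧
  (∀ b, b < q - 1 → BlockOK r (fun i => f₂.coeff (1 + b * r + i)) ((-1) ^ b)) ∧
  BlockOK (r - 1) (fun i => f₂.coeff (1 + (q - 1) * r + i)) 1

/-- The partial sums of an OK block: each is `ε` or `0` according to the parity of the number of
nonzero entries seen so far, and this parity also determines the last nonzero entry. -/
lemma BlockOK.sum_range_eq_ite {L : ℕ} {v : ℕ → ℤ} {ε : ℤ} (h : BlockOK L v ε) (j : ℕ)
    (hj : j ≤ L) :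
    (∑ i ∈ Finset.range j, v i =
      if Odd (((Finset.range j).filter fun i => v i ≠ 0).card) then ε else 0) ∧
    (∀ i, i < j → v i ≠ 0 → (∀ k, i < k → k < j → v k = 0) →
      v i = if Odd (((Finset.range j).filter fun i => v i ≠ 0).card) then ε else -ε) := by
  obtain ⟨-, -, halt, hfirst⟩ := h
  induction j with
  | zero => simp
  | succ j ih =>
    obtain ⟨hsum, hlast⟩ := ih (by omega)
    rw [Finset.sum_range_succ, Finset.range_add_one, Finset.filter_insert]
    by_cases hv : v j = 0
    · simp only [hv, ne_eq, not_true_eq_false, if_false, add_zero]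
      refine ⟨hsum, fun i hi hvi hz => ?_⟩
      have hij : i ≠ j := by rintro rfl; exact hvi hv
      exact hlast i (by omega) hvi fun k h1 h2 => hz k h1 (by omega)
    · have hvj : v j = if Odd (((Finset.range j).filter fun i => v i ≠ 0).card)
          then -ε else ε := by
        rcases ((Finset.range j).filter fun i => v i ≠ 0).eq_empty_or_nonempty with he | hne
        · rw [he]
          simp only [Finset.card_empty, Nat.not_odd_zero, if_false]
          refine hfirst j (by omega) hv fun k hk => ?_
          by_contra hk0
          have : k ∈ (Finset.range j).filter fun i => v i ≠ 0 := by simp [hk, hk0]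
          simp [he] at this
        · obtain ⟨i, hi, hmax⟩ := Finset.exists_max_image _ id hne
          simp only [Finset.mem_filter, Finset.mem_range, id] at hi hmax
          have hz : ∀ k, i < k → k < j → v k = 0 := by
            intro k h1 h2
            by_contra hk0
            exact absurd (hmax k ⟨h2, hk0⟩) (by omega)
          rw [halt i j hi.1 (by omega) hi.2 hv hz, hlast i hi.1 hi.2 hz]
          split_ifs <;> simp
      rw [if_pos hv, Finset.card_insert_of_notMem (by simp), hsum]
      simp only [Nat.odd_add_one]
      refine ⟨?_, fun i hi hvi hz => ?_⟩
      · rw [hvj]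
        split_ifs <;> simp
      · have hij : i = j := by
          by_contra hij
          exact hv (hz j (by omega) (by omega))
        rw [hij, hvj]
        split_ifs <;> simp_all

lemma BlockOK.sum_range_mem {L : ℕ} {v : ℕ → ℤ} {ε : ℤ} (h : BlockOK L v ε) {j : ℕ}
    (hj : j ≤ L) : ∑ i ∈ Finset.range j, v i = 0 ∨ ∑ i ∈ Finset.range j, v i = ε := by
  rw [(h.sum_range_eq_ite j hj).1]
  split_ifs <;> simp

lemma BlockOK.sum_range {L : ℕ} {v : ℕ → ℤ} {ε : ℤ} (h : BlockOK L v ε) :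
    ∑ i ∈ Finset.range L, v i = ε := by
  rw [(h.sum_range_eq_ite L le_rfl).1, if_pos h.2.1]

/-- The sum of the coefficients of `z^0, …, z^k`. -/
noncomputable def prefixSum (k : ℕ) : ℤ[X] →ₗ[ℤ] ℤ :=
  ∑ l ∈ Finset.range (k + 1), lcoeff ℤ l

lemma prefixSum_apply (k : ℕ) (f : ℤ[X]) :
    prefixSum k f = ∑ l ∈ Finset.range (k + 1), f.coeff l := by
  simp [prefixSum, LinearMap.sum_apply]

lemma prefixSum_zero (f : ℤ[X]) : prefixSum 0 f = f.coeff 0 := by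
  simp [prefixSum_apply]

lemma prefixSum_succ (k : ℕ) (f : ℤ[X]) :
    prefixSum (k + 1) f = prefixSum k f + f.coeff (k + 1) := by
  simp [prefixSum_apply, Finset.sum_range_succ]

lemma prefixSum_X_pow_mul (k a : ℕ) (f : ℤ[X]) :
    prefixSum k (X ^ a * f) = if a ≤ k then prefixSum (k - a) f else 0 := by
  induction k with
  | zero =>
    rw [prefixSum_zero, coeff_X_pow_mul']
    simp [prefixSum_zero]
  | succ k ih =>
    rw [prefixSum_succ, ih, coeff_X_pow_mul']
    rcases lt_trichotomy a (k + 1) with h | h | h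
    · rw [if_pos (by omega), if_pos (by omega), if_pos (by omega),
        show k + 1 - a = (k - a) + 1 by omega, prefixSum_succ]
    · subst h
      simp [prefixSum_zero]
    · rw [if_neg (by omega), if_neg (by omega), if_neg (by omega), add_zero]

lemma prefixSum_one_sub_X (k : ℕ) : prefixSum k (1 - X) = if k = 0 then 1 else 0 := by
  induction k with
  | zero => simp [prefixSum_zero]
  | succ k ih =>
    rw [prefixSum_succ, ih]
    cases k <;> simp [coeff_one, coeff_X]

lemma prefixSum_neg_one_pow_mul (k s : ℕ) (f : ℤ[X]) :
    prefixSum k ((-1) ^ s * f) = (-1) ^ s * prefixSum k f := by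
  rcases Nat.even_or_odd s with h | h <;> simp [h.neg_one_pow]

/-- A polynomial whose prefix sums below `n` lie in `{0, 1}` and whose coefficients vanish from `n`
on has coefficients in `{-1, 0, 1}` that alternate in sign. -/
lemma coeff_mem_and_altSigns_of_prefixSum {n : ℕ} {F : ℤ[X]}
    (hz : ∀ k, n ≤ k → F.coeff k = 0)
    (h : ∀ k, k < n → prefixSum k F = 0 ∨ prefixSum k F = 1) :
    (∀ k, F.coeff k ∈ ({-1, 0, 1} : Set ℤ)) ∧ AltSigns F := by
  refine ⟨fun k => ?_, fun i j hij hi hj hbetween => ?_⟩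
  · simp only [Set.mem_insert_iff, Set.mem_singleton_iff]
    rcases le_or_gt n k with hk | hk
    · exact Or.inr (Or.inl (hz k hk))
    · cases k with
      | zero => have := h 0 hk; rw [prefixSum_zero] at this; omega
      | succ k =>
        have h1 := h k (by omega)
        have h2 := h (k + 1) hk
        rw [prefixSum_succ] at h2
        omega
  · have hjn : j < n := by
      by_contra hjn
      exact hj (hz j (by omega))
    have hconst : ∀ d, i + d < j → prefixSum (i + d) F = prefixSum i F := by
      intro d
      induction d with
      | zero => simp
      | succ d ih =>
        intro hd
        rw [← add_assoc, prefixSum_succ, ih (by omega), hbetween _ (by omega) (by omega),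
          add_zero]
    obtain ⟨d, rfl⟩ : ∃ d, j = i + d + 1 := ⟨j - i - 1, by omega⟩
    have hjs := h _ hjn
    have hd := hconst d (by omega)
    have his := h i (by omega)
    rw [prefixSum_succ, hd] at hjs
    cases i with
    | zero => rw [prefixSum_zero] at *; omega
    | succ i =>
      have hip := h i (by omega)
      rw [prefixSum_succ] at *
      omega

lemma neg_one_pow_eq_ite_odd (b : ℕ) : (-1 : ℤ) ^ b = if Odd b then -1 else 1 := by
  split_ifs with h
  · exact h.neg_one_pow
  · exact (Nat.not_odd_iff_even.mp h).neg_one_pow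

lemma sum_range_neg_one_pow (n : ℕ) :
    ∑ i ∈ Finset.range n, (-1 : ℤ) ^ i = if Odd n then 1 else 0 := by
  induction n with
  | zero => simp
  | succ n ih =>
    rw [Finset.sum_range_succ, ih, neg_one_pow_eq_ite_odd]
    simp only [Nat.odd_add_one]
    split_ifs <;> simp

lemma Admissible.prefixSum_eq {q r : ℕ} {f : ℤ[X]} (hf : Admissible q r f) (k : ℕ) :
    prefixSum k f = ∑ l ∈ Finset.range k, f.coeff (1 + l) := by
  rw [prefixSum_apply, Finset.sum_range_succ', hf.2.1, add_zero]
  simp only [add_comm]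

lemma Admissible.prefixSum_mul_add {q r : ℕ} {f : ℤ[X]} (hf : Admissible q r f) (b i : ℕ) :
    prefixSum (b * r + i) f =
      prefixSum (b * r) f + ∑ l ∈ Finset.range i, f.coeff (1 + b * r + l) := by
  simp only [hf.prefixSum_eq, Finset.sum_range_add, add_assoc]

lemma Admissible.prefixSum_mul {q r : ℕ} {f : ℤ[X]} (hf : Admissible q r f) (b : ℕ)
    (hb : b ≤ q - 1) : prefixSum (b * r) f = if Odd b then 1 else 0 := by
  induction b with
  | zero => simp [prefixSum_zero, hf.2.1]
  | succ b ih =>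
    rw [add_one_mul, hf.prefixSum_mul_add, ih (by omega), (hf.2.2.1 b (by omega)).sum_range,
      neg_one_pow_eq_ite_odd]
    simp only [Nat.odd_add_one]
    split_ifs <;> simp

lemma Admissible.prefixSum_mem {q r : ℕ} {f : ℤ[X]} (hf : Admissible q r f) (hq : Odd q)
    {k : ℕ} (hk : k < q * r) : prefixSum k f = 0 ∨ prefixSum k f = 1 := by
  have hr : 0 < r := Nat.pos_of_mul_pos_left (by omega : 0 < q * r)
  have hb : k / r < q := Nat.div_lt_of_lt_mul (by rwa [mul_comm])
  have hi : k % r < r := Nat.mod_lt _ hr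
  have hdecomp : k / r * r + k % r = k := Nat.div_add_mod' k r
  rw [← hdecomp, hf.prefixSum_mul_add, hf.prefixSum_mul _ (by omega)]
  by_cases hlast : k / r < q - 1
  · have := (hf.2.2.1 _ hlast).sum_range_mem hi.le
    beta_reduce at this
    rw [neg_one_pow_eq_ite_odd] at this
    split_ifs at * <;> omega
  · have hbq : k / r = q - 1 := by omega
    have := hf.2.2.2.sum_range_mem (by omega : k % r ≤ r - 1)
    rw [hbq, if_neg (by rw [Nat.not_odd_iff_even]; exact hq.tsub_odd odd_one), zero_add]
    exact this

lemma Admissible.prefixSum_of_le {q r : ℕ} {f : ℤ[X]} (hf : Admissible q r f) (hq : Odd q)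
    (hr : 0 < r) {k : ℕ} (hk : q * r ≤ k + 1) : prefixSum k f = 1 := by
  have hq0 := hq.pos
  have hqr : (q - 1) * r + (r - 1) + 1 = q * r := by
    obtain ⟨q, rfl⟩ : ∃ t, q = t + 1 := ⟨q - 1, by omega⟩
    rw [Nat.add_sub_cancel, add_one_mul]
    omega
  obtain ⟨d, rfl⟩ : ∃ d, k = (q - 1) * r + (r - 1) + d := ⟨k + 1 - q * r, by omega⟩
  clear hk
  induction d with
  | zero =>
    rw [add_zero, hf.prefixSum_mul_add, hf.prefixSum_mul _ le_rfl, hf.2.2.2.sum_range,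
      if_neg (by rw [Nat.not_odd_iff_even]; exact hq.tsub_odd odd_one), zero_add]
  | succ d ih =>
    rw [← add_assoc, prefixSum_succ, ih, coeff_eq_zero_of_degree_lt, add_zero]
    exact hf.1.trans_le (by exact_mod_cast (by omega))

lemma cyclotomic_prime_comp_neg_X_pow {q : ℕ} (hq : q.Prime) (a : ℕ) :
    (cyclotomic q ℤ).comp (-(X ^ a)) = ∑ j ∈ Finset.range q, (-1) ^ j * X ^ (a * j) := by
  have := Fact.mk hq
  rw [cyclotomic_prime, ← coe_compRingHom_apply, map_sum]
  refine Finset.sum_congr rfl fun j _ => ?_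
  rw [map_pow, coe_compRingHom_apply, X_comp, neg_pow, pow_mul]

lemma cyclotomic_dvd_cyclotomic_prime_comp {q m : ℕ} (hq : q.Prime) (hoq : Odd q) (hm : 0 < m) :
    cyclotomic (2 * (q * m)) ℤ ∣ (cyclotomic q ℤ).comp (-(X ^ m)) := by
  have hn : 0 < 2 * (q * m) := by have := hq.pos; positivity
  have hζ := Complex.isPrimitiveRoot_exp _ hn.ne'
  set ζ := Complex.exp (2 * Real.pi * Complex.I / ((2 * (q * m) : ℕ) : ℂ))
  rw [cyclotomic_eq_minpoly hζ hn]
  refine minpoly.isIntegrallyClosed_dvd (hζ.isIntegral hn) ?_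
  have hneg : ζ ^ (q * m) = -1 := by
    have h1 : IsPrimitiveRoot (ζ ^ (q * m)) 2 := hζ.pow hn (mul_comm _ _)
    exact h1.eq_neg_one_of_two_right
  have hne : -ζ ^ m - 1 ≠ 0 := by
    intro h0
    have h1 : ζ ^ (m * 2) = 1 := by
      rw [pow_mul, show ζ ^ m = -1 by linear_combination -h0]
      norm_num
    have h2 := Nat.le_of_dvd (by omega) (hζ.dvd_of_pow_eq_one _ h1)
    have := hq.two_le
    nlinarith
  have := Fact.mk hq
  have key := congrArg (eval (-ζ ^ m)) (cyclotomic_prime_mul_X_sub_one ℂ q)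
  simp only [eval_mul, eval_sub, eval_X, eval_one, eval_pow] at key
  rw [hoq.neg_pow, ← pow_mul, mul_comm m q, hneg, neg_neg, sub_self] at key
  have := (mul_eq_zero.mp key).resolve_right hne
  rw [aeval_comp, aeval_def, eval₂_eq_eval_map, map_cyclotomic]
  simpa using this

lemma degree_sum_neg_one_pow_mul_lt {N a d : ℕ} {f : ℤ[X]} (hf : f.degree < (a : WithBot ℕ))
    (h : d = a * N) :
    (f * ∑ j ∈ Finset.range N, (-1) ^ j * X ^ (a * j)).degree < (d : WithBot ℕ) := by
  rw [← mem_degreeLT] at *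
  rw [Finset.mul_sum]
  refine Submodule.sum_mem _ fun j hj => ?_
  rw [mem_degreeLT, degree_lt_iff_coeff_zero] at *
  intro k hk
  have hj' : j + 1 ≤ N := Finset.mem_range.mp hj
  have : a * j + a ≤ k := by nlinarith
  rw [show f * ((-1) ^ j * X ^ (a * j)) = C ((-1) ^ j) * (X ^ (a * j) * f) by
    simp only [map_pow, map_neg, map_one]; ring, coeff_C_mul, coeff_X_pow_mul',
    if_pos (by omega), hf _ (by omega), mul_zero]

/-- The prefix sums of `f · Φ_p(-z^{qr})` for admissible `f`. -/
lemma Admissible.prefixSum_sum {p q r : ℕ} {f : ℤ[X]} (hf : Admissible q r f) (hq : Odd q)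
    (hr : 0 < r) {i l : ℕ} (hi : i < p) (hl : l < q * r) :
    ∑ j ∈ Finset.range p, (-1 : ℤ) ^ j *
      (if q * r * j ≤ q * r * i + l then prefixSum (q * r * i + l - q * r * j) f else 0) =
    (if Odd i then 1 else 0) + (-1) ^ i * prefixSum l f := by
  obtain ⟨d, rfl⟩ : ∃ d, p = i + 1 + d := ⟨p - (i + 1), by omega⟩
  rw [Finset.sum_range_add, Finset.sum_range_succ, Finset.sum_eq_zero (s := Finset.range d)]
  · rw [if_pos (by omega), Nat.add_sub_cancel_left, add_zero, ← sum_range_neg_one_pow]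
    congr 1
    refine Finset.sum_congr rfl fun j hj => ?_
    have : q * r * j + q * r ≤ q * r * i := by
      have := Finset.mem_range.mp hj
      nlinarith
    rw [if_pos (by omega), hf.prefixSum_of_le hq hr (by omega), mul_one]
  · intro j _
    rw [if_neg, mul_zero]
    nlinarith

/-- At most one term of the double sum over `s` and `j` survives. -/
lemma sum_neg_one_pow_ite_eq {p q r k : ℕ} (hop : Odd p) (hr : 0 < r) {S : Finset ℕ}
    (hS : S ⊆ Finset.range p) :
    (∑ s ∈ S, ∑ j ∈ Finset.range q, (-1 : ℤ) ^ (s + j) *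
      (if k = r * s + p * r * j then 1 else 0) = 0) ∨
    ∃ m, k = r * m ∧ (∑ s ∈ S, ∑ j ∈ Finset.range q, (-1 : ℤ) ^ (s + j) *
      (if k = r * s + p * r * j then 1 else 0) = (-1) ^ m) := by
  by_cases h : ∃ s ∈ S, ∃ j ∈ Finset.range q, k = r * s + p * r * j
  · obtain ⟨s, hs, j, hj, rfl⟩ := h
    refine Or.inr ⟨s + p * j, by ring, ?_⟩
    have huniq : ∀ s' ∈ S, ∀ j', r * s + p * r * j = r * s' + p * r * j' → s' = s ∧ j' = j := by
      intro s' hs' j' he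
      have he' : s + p * j = s' + p * j' := by
        apply Nat.eq_of_mul_eq_mul_left hr
        linarith
      have hs1 := Finset.mem_range.mp (hS hs)
      have hs2 := Finset.mem_range.mp (hS hs')
      have hss : s' = s := by
        have := congrArg (· % p) he'
        simpa [Nat.add_mul_mod_self_left, Nat.mod_eq_of_lt hs1, Nat.mod_eq_of_lt hs2]
          using this.symm
      subst hss
      exact ⟨rfl, Nat.eq_of_mul_eq_mul_left hop.pos (by omega)⟩
    rw [Finset.sum_eq_single_of_mem s hs, Finset.sum_eq_single_of_mem j hj, if_pos rfl, mul_one,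
      pow_add, pow_add, pow_mul, hop.neg_one_pow]
    · intro j' _ hne
      rw [if_neg fun he => hne (huniq s hs j' he).2, mul_zero]
    · intro s' hs' hne
      refine Finset.sum_eq_zero fun j' _ => ?_
      rw [if_neg fun he => hne (huniq s' hs' j' he).1, mul_zero]
  · left
    push Not at h
    refine Finset.sum_eq_zero fun s hs => Finset.sum_eq_zero fun j hj => ?_
    rw [if_neg (h s hs j hj), mul_zero]

/-- With `p, q` distinct odd primes, `r ≥ 2`, `n = pqr`, a nonempty proper
subset `S ⊂ {0, …, p-1}`, `f₁(z) = Σ_{s∈S} (-1)^s z^{rs}(1-z)`, and `f₂` admissible, the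
polynomial `F = f₁·Φ_q(-z^{pr}) + f₂·Φ_p(-z^{qr})` satisfies `deg F < n`, all coefficients
of `F` lie in `{-1, 0, 1}`, the nonzero coefficients of `F` alternate in sign, and
`Φ_{2n} ∣ F`. -/
theorem general_construction_properties (p q r : ℕ) (hp : p.Prime) (hq : q.Prime)
    (hop : Odd p) (hoq : Odd q) (hpq : p ≠ q) (hr : 2 ≤ r)
    (S : Finset ℕ) (hS : S.Nonempty) (hS' : S ⊂ Finset.range p)
    (f₂ : Polynomial ℤ) (hf₂ : Admissible q r f₂) (F : Polynomial ℤ)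
    (hF : F = (∑ s ∈ S, (-1 : Polynomial ℤ) ^ s * X ^ (r * s) * (1 - X))
            * (cyclotomic q ℤ).comp (-(X ^ (p * r)))
          + f₂ * (cyclotomic p ℤ).comp (-(X ^ (q * r)))) :
    F.degree < ((p * q * r : ℕ) : WithBot ℕ) ∧
    (∀ k, F.coeff k ∈ ({-1, 0, 1} : Set ℤ)) ∧
    AltSigns F ∧
    cyclotomic (2 * (p * q * r)) ℤ ∣ F := by
  have hr0 : 0 < r := by omega
  have hq0 := hq.pos
  have hp0 := hp.pos
  have hdeg : F.degree < ((p * q * r : ℕ) : WithBot ℕ) := by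
    rw [hF, cyclotomic_prime_comp_neg_X_pow hq, cyclotomic_prime_comp_neg_X_pow hp]
    refine (degree_add_le _ _).trans_lt (max_lt (degree_sum_neg_one_pow_mul_lt ?_ (by ring))
      (degree_sum_neg_one_pow_mul_lt hf₂.1 (by ring)))
    rw [← mem_degreeLT]
    refine Submodule.sum_mem _ fun s hs => ?_
    rw [mem_degreeLT, degree_lt_iff_coeff_zero]
    intro k hk
    have hsp : s + 1 ≤ p := Finset.mem_range.mp (hS'.subset hs)
    have hle : r * s + r ≤ k := by nlinarith
    rw [show (-1 : ℤ[X]) ^ s * X ^ (r * s) * (1 - X) = C ((-1) ^ s) * (X ^ (r * s) * (1 - X)) by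
      simp only [map_pow, map_neg, map_one]; ring, coeff_C_mul, coeff_X_pow_mul',
      if_pos (by omega), coeff_sub, coeff_one, coeff_X, if_neg (by omega), if_neg (by omega),
      sub_zero, mul_zero]
  have hprefix : ∀ k, prefixSum k F =
      (∑ s ∈ S, ∑ j ∈ Finset.range q, (-1 : ℤ) ^ (s + j) *
        (if k = r * s + p * r * j then 1 else 0)) +
      ∑ j ∈ Finset.range p, (-1 : ℤ) ^ j *
        (if q * r * j ≤ k then prefixSum (k - q * r * j) f₂ else 0) := by
    intro k
    rw [hF, cyclotomic_prime_comp_neg_X_pow hq, cyclotomic_prime_comp_neg_X_pow hp, map_add,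
      Finset.sum_mul, Finset.mul_sum, map_sum, map_sum]
    congr 1
    · refine Finset.sum_congr rfl fun s _ => ?_
      rw [Finset.mul_sum, map_sum]
      refine Finset.sum_congr rfl fun j _ => ?_
      rw [show (-1 : ℤ[X]) ^ s * X ^ (r * s) * (1 - X) * ((-1) ^ j * X ^ (p * r * j)) =
        (-1) ^ (s + j) * (X ^ (r * s + p * r * j) * (1 - X)) by ring,
        prefixSum_neg_one_pow_mul, prefixSum_X_pow_mul, prefixSum_one_sub_X]
      congr 1
      split_ifs <;> first | rfl | omega
    · refine Finset.sum_congr rfl fun j _ => ?_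
      rw [show f₂ * ((-1) ^ j * X ^ (q * r * j)) = (-1) ^ j * (X ^ (q * r * j) * f₂) by ring,
        prefixSum_neg_one_pow_mul, prefixSum_X_pow_mul]
  have hsum : ∀ k, k < p * q * r → prefixSum k F = 0 ∨ prefixSum k F = 1 := by
    intro k hk
    have hqr : 0 < q * r := Nat.mul_pos hq0 hr0
    have hl : k % (q * r) < q * r := Nat.mod_lt _ hqr
    have hi : k / (q * r) < p := Nat.div_lt_of_lt_mul (by linarith)
    have hkd : q * r * (k / (q * r)) + k % (q * r) = k := Nat.div_add_mod k (q * r)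
    have h2 := hf₂.prefixSum_sum hoq hr0 hi hl
    have hC := hf₂.prefixSum_mem hoq hl
    rw [hkd, neg_one_pow_eq_ite_odd (k / (q * r))] at h2
    rw [hprefix, h2]
    rcases sum_neg_one_pow_ite_eq (q := q) (k := k) hop hr0 hS'.subset with h1 | ⟨m, hm, h1⟩
    · rw [h1]
      split_ifs <;> omega
    · have hb : m % q < q := Nat.mod_lt _ hq0
      have hmd : q * (m / q) + m % q = m := Nat.div_add_mod m q
      have hmi : k / (q * r) = m / q := by
        rw [hm, mul_comm q r, Nat.mul_div_mul_left _ _ hr0]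
      have hml : k % (q * r) = m % q * r := by
        rw [hm, mul_comm q r, Nat.mul_mod_mul_left, mul_comm]
      have hpar : Odd m ↔ ¬ (Odd (m / q) ↔ Odd (m % q)) := by
        conv_lhs => rw [← hmd]
        simp only [Nat.odd_add, Nat.odd_mul, hoq, true_and, ← Nat.not_odd_iff_even]
        tauto
      rw [h1, hmi, hml, hf₂.prefixSum_mul _ (by omega), neg_one_pow_eq_ite_odd m, if_congr hpar rfl rfl]
      by_cases ha : Odd (m / q) <;> by_cases hb : Odd (m % q) <;> simp [ha, hb]
  obtain ⟨hcoeff, halt⟩ := coeff_mem_and_altSigns_of_prefixSum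
    ((degree_lt_iff_coeff_zero _ _).mp hdeg) hsum
  refine ⟨hdeg, hcoeff, halt, ?_⟩
  rw [hF]
  refine dvd_add (Dvd.dvd.mul_left ?_ _) (Dvd.dvd.mul_left ?_ _)
  · rw [show p * q * r = q * (p * r) by ring]
    exact cyclotomic_dvd_cyclotomic_prime_comp hq hoq (Nat.mul_pos hp0 hr0)
  · rw [show p * q * r = p * (q * r) by ring]
    exact cyclotomic_dvd_cyclotomic_prime_comp hp hop (Nat.mul_pos hq0 hr0)
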